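/- Let N ≥ 1 and k ≥ 2, and let z_1, …, z_k ∈ ℝ^N be pairwise distinct points. Then it is impossible that for every index j ∈ {1,…,k} one has ∑_{i=1, i≠j}^{k} (z_i − z_j)/|z_i − z_j|^N = 0; that is, there exists some j ∈ {1,…,k} with ∑_{i≠j} (z_i − z_j)/|z_i − z_j|^N ≠ 0. -/

import Mathlib

/-- For `N ≥ 1`, `k ≥ 2` and pairwise distinct points `z 1, …, z k` in `ℝ^N`,
it is impossible that for every `j` one has `∑_{i ≠ j} (z i − z j)/|z i − z j|^N = 0`;
that is, there is some `j` for which this sum is nonzero. -/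
theorem statement0 (N k : ℕ) (hN : 1 ≤ N) (hk : 2 ≤ k)
    (z : Fin k → EuclideanSpace ℝ (Fin N))
    (hz : Function.Injective z) :
    ∃ j : Fin k,
      ∑ i ∈ Finset.univ.erase j, (‖z i - z j‖ ^ N)⁻¹ • (z i - z j) ≠ 0 := by
  have : Nonempty (Fin k) := ⟨⟨0, by omega⟩⟩
  have : Nontrivial (Fin k) := Fin.nontrivial_iff_two_le.mpr hk
  -- A point of maximal norm sees all the others strictly on one side.
  obtain ⟨j, hj⟩ := Finite.exists_max fun i => ‖z i‖
  refine ⟨j, fun h => ?_⟩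
  have hneg : ∑ i ∈ Finset.univ.erase j,
      inner ℝ (z j) ((‖z i - z j‖ ^ N)⁻¹ • (z i - z j)) < 0 := by
    refine Finset.sum_neg (fun i hi => ?_) ?_
    · have hpos : 0 < ‖z i - z j‖ :=
        norm_pos_iff.mpr (sub_ne_zero.mpr (hz.ne (Finset.ne_of_mem_erase hi)))
      rw [real_inner_smul_right]
      refine mul_neg_of_pos_of_neg (by positivity) ?_
      have hsq := norm_sub_sq_real (z i) (z j)
      have hle : ‖z i‖ ^ 2 ≤ ‖z j‖ ^ 2 := pow_le_pow_left₀ (norm_nonneg _) (hj i) 2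
      rw [inner_sub_right, real_inner_self_eq_norm_sq, real_inner_comm]
      linarith [pow_pos hpos 2]
    · obtain ⟨i, hi⟩ := exists_ne j
      exact ⟨i, Finset.mem_erase.mpr ⟨hi, Finset.mem_univ i⟩⟩
  rw [← inner_sum, h, inner_zero_right] at hneg
  exact lt_irrefl _ hneg
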